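/- Let η ∈ (0, 1) and L > 0, and let a : ℝ → ℝ satisfy |a(x) − a(y)| ≤ L(|x − y|^η + |x − y|) for all x, y ∈ ℝ. Then there exists a constant C > 0, depending only on L and η, such that: for every x ∈ ℝ and any two continuous functions f¹, f² : [0, 1] → ℝ with fⁱ(t) = x + ∫₀ᵗ a(fⁱ(s)) ds for all t ∈ [0, 1] (i = 1, 2), one has |f¹(t) − f²(t)| ≤ C t^{1/(1−η)} for all t ∈ [0, 1]. -/

import Mathlib

open MeasureTheory

/-- A function vanishing at `0` with `|g'| ≤ L (|g| ^ η + |g|)` satisfies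
`|g t| ≤ (2 L t) ^ (1 / (1 - η))` as long as `L t ≤ 1 / 2`. -/
theorem abs_le_rpow_of_abs_deriv_le {η L T : ℝ} (hη0 : 0 ≤ η) (hη1 : η < 1) (hL : 0 ≤ L)
    {g g' : ℝ → ℝ} (hg : ∀ t, HasDerivAt g (g' t) t) (hg0 : g 0 = 0)
    (hT : 0 ≤ T) (hLT : L * T ≤ 1 / 2)
    (hbound : ∀ t ∈ Set.Icc 0 T, |g' t| ≤ L * (|g t| ^ η + |g t|)) :
    |g T| ≤ (2 * L * T) ^ (1 / (1 - η)) := by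
  have hcont : ContinuousOn (fun t => |g t|) (Set.Icc 0 T) := fun t _ =>
    (hg t).continuousAt.abs.continuousWithinAt
  obtain ⟨s, hs, hmax⟩ := isCompact_Icc.exists_isMaxOn (Set.nonempty_Icc.2 hT) hcont
  have hle : ∀ t ∈ Set.Icc 0 T, |g t| ≤ |g s| := fun t ht => hmax ht
  have hmean : |g s| ≤ L * (|g s| ^ η + |g s|) * T := by
    have key := (convex_Icc (0 : ℝ) T).norm_image_sub_le_of_norm_hasDerivWithin_le
      (f := g) (f' := g') (C := L * (|g s| ^ η + |g s|))
      (fun t _ => (hg t).hasDerivWithinAt)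
      (fun t ht => (hbound t ht).trans (by
        have := hle t ht
        gcongr))
      (Set.left_mem_Icc.2 hT) hs
    simp only [hg0, sub_zero, Real.norm_eq_abs, abs_of_nonneg hs.1] at key
    exact key.trans (by gcongr; exact hs.2)
  refine (hle T (Set.right_mem_Icc.2 hT)).trans ?_
  rcases (abs_nonneg (g s)).eq_or_lt with h0 | hpos
  · rw [← h0]
    positivity
  · have hsub : |g s| ≤ 2 * L * T * |g s| ^ η := by nlinarith
    have hpow : |g s| ^ (1 - η) ≤ 2 * L * T := by
      rw [Real.rpow_sub hpos, Real.rpow_one]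
      exact (div_le_iff₀ (by positivity)).2 hsub
    calc |g s| = (|g s| ^ (1 - η)) ^ (1 / (1 - η)) := by
          rw [← Real.rpow_mul hpos.le, mul_one_div_cancel (by linarith), Real.rpow_one]
      _ ≤ _ := by
          have : 0 ≤ 1 / (1 - η) := one_div_nonneg.2 (by linarith)
          gcongr

/-- A function vanishing at `0` with `|g'| ≤ L (|g| ^ η + |g|)` on `[0, 1]` is bounded there by
a constant depending only on `L`. -/
theorem abs_le_gronwallBound_of_abs_deriv_le {η L : ℝ} (hη0 : 0 ≤ η) (hη1 : η ≤ 1) (hL : 0 ≤ L)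
    {g g' : ℝ → ℝ} (hg : ∀ t, HasDerivAt g (g' t) t) (hg0 : g 0 = 0)
    (hbound : ∀ t ∈ Set.Icc (0 : ℝ) 1, |g' t| ≤ L * (|g t| ^ η + |g t|))
    {t : ℝ} (ht : t ∈ Set.Icc (0 : ℝ) 1) :
    |g t| ≤ gronwallBound 0 (2 * L) L 1 := by
  have key := norm_le_gronwallBound_of_norm_deriv_right_le (f := g) (f' := g') (δ := 0)
    (K := 2 * L) (ε := L) (a := 0) (b := 1)
    (fun t _ => (hg t).continuousAt.continuousWithinAt)
    (fun t _ => (hg t).hasDerivWithinAt) (by simp [hg0])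
    (fun t ht => (hbound t (Set.Ico_subset_Icc_self ht)).trans (by
      have hrpow : |g t| ^ η ≤ 1 + |g t| := by
        rcases le_total |g t| 1 with h | h
        · linarith [Real.rpow_le_one (abs_nonneg (g t)) h hη0, abs_nonneg (g t)]
        · have := Real.rpow_le_rpow_of_exponent_le h hη1
          rw [Real.rpow_one] at this
          linarith
      rw [Real.norm_eq_abs]
      nlinarith)) t ht
  rw [sub_zero] at key
  exact key.trans (gronwallBound_mono le_rfl hL (by positivity) ht.2)

/-- A function whose increments are bounded by those of a Hölder-plus-Lipschitz modulus is
continuous. -/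
theorem continuous_of_abs_sub_le_rpow_add {η L : ℝ} (hη : 0 < η) {a : ℝ → ℝ}
    (ha : ∀ x y : ℝ, |a x - a y| ≤ L * (|x - y| ^ η + |x - y|)) : Continuous a := by
  refine continuous_iff_continuousAt.2 fun y => ?_
  refine tendsto_iff_dist_tendsto_zero.2 (squeeze_zero (fun _ => dist_nonneg) (fun x => ha x y) ?_)
  have hc : Continuous fun x : ℝ => L * (|x - y| ^ η + |x - y|) := by
    have : Continuous fun x : ℝ => |x - y| := by fun_prop
    exact continuous_const.mul ((this.rpow_const fun _ => Or.inr hη.le).add this)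
  simpa [Real.zero_rpow hη.ne'] using hc.tendsto y

/-- Any two solutions of the Cauchy problem `df_t = a(f_t) dt`, `f_0 = x`, with an
`η`-Hölder drift differ by at most `C t^{1/(1-η)}` on `[0,1]`, where `C` depends
only on `L` and `η`. -/
theorem ode_two_solutions_close (η L : ℝ) (hη : η ∈ Set.Ioo (0 : ℝ) 1) (hL : 0 < L) :
    ∃ C > 0, ∀ a : ℝ → ℝ,
      (∀ x y : ℝ, |a x - a y| ≤ L * (|x - y| ^ η + |x - y|)) →
      ∀ (x : ℝ) (f₁ f₂ : ℝ → ℝ),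
        ContinuousOn f₁ (Set.Icc 0 1) → ContinuousOn f₂ (Set.Icc 0 1) →
        (∀ t ∈ Set.Icc (0 : ℝ) 1, f₁ t = x + ∫ s in (0 : ℝ)..t, a (f₁ s)) →
        (∀ t ∈ Set.Icc (0 : ℝ) 1, f₂ t = x + ∫ s in (0 : ℝ)..t, a (f₂ s)) →
        ∀ t ∈ Set.Icc (0 : ℝ) 1, |f₁ t - f₂ t| ≤ C * t ^ (1 / (1 - η)) := by
  obtain ⟨hη0, hη1⟩ := hη
  have hK : 0 ≤ gronwallBound 0 (2 * L) L 1 := by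
    have := gronwallBound_mono (δ := 0) le_rfl hL.le (by positivity : 0 ≤ 2 * L) zero_le_one
    rwa [gronwallBound_x0] at this
  set K := gronwallBound 0 (2 * L) L 1
  refine ⟨(K + 1) * (2 * L) ^ (1 / (1 - η)), by positivity, ?_⟩
  intro a ha x f₁ f₂ hf₁ hf₂ h₁ h₂ t ht
  have hacont := continuous_of_abs_sub_le_rpow_add hη0 ha
  set h : ℝ → ℝ := Set.IccExtend zero_le_one
    ((Set.Icc (0 : ℝ) 1).domRestrict fun s => a (f₁ s) - a (f₂ s))
  have hh : ∀ s ∈ Set.Icc (0 : ℝ) 1, h s = a (f₁ s) - a (f₂ s) := fun s hs =>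
    Set.IccExtend_of_mem zero_le_one _ hs
  have haf₁ : ContinuousOn (fun s => a (f₁ s)) (Set.Icc 0 1) := hacont.comp_continuousOn hf₁
  have haf₂ : ContinuousOn (fun s => a (f₂ s)) (Set.Icc 0 1) := hacont.comp_continuousOn hf₂
  have hhcont : Continuous h := (haf₁.sub haf₂).domRestrict.Icc_extend'
  set g : ℝ → ℝ := fun t => ∫ s in (0 : ℝ)..t, h s
  have hg : ∀ t, HasDerivAt g (h t) t := fun t => hhcont.integral_hasStrictDerivAt 0 t |>.hasDerivAt
  have hgf : ∀ t ∈ Set.Icc (0 : ℝ) 1, g t = f₁ t - f₂ t := by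
    intro t ht
    have hsub : Set.uIcc 0 t ⊆ Set.Icc (0 : ℝ) 1 := by
      rw [Set.uIcc_of_le ht.1]
      exact Set.Icc_subset_Icc_right ht.2
    rw [h₁ t ht, h₂ t ht, add_sub_add_left_eq_sub, ← intervalIntegral.integral_sub
      (haf₁.mono hsub).intervalIntegrable (haf₂.mono hsub).intervalIntegrable]
    exact intervalIntegral.integral_congr fun s hs => hh s (hsub hs)
  have hg0 : g 0 = 0 := intervalIntegral.integral_same
  have hbound : ∀ s ∈ Set.Icc (0 : ℝ) 1, |h s| ≤ L * (|g s| ^ η + |g s|) := by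
    intro s hs
    rw [hh s hs, hgf s hs]
    exact ha _ _
  have hp : 0 ≤ 1 / (1 - η) := one_div_nonneg.2 (by linarith)
  rw [← hgf t ht, mul_assoc, ← Real.mul_rpow (by positivity) ht.1]
  have ht0 : 0 ≤ 2 * L * t := mul_nonneg (by positivity) ht.1
  rcases le_total (L * t) (1 / 2) with hLt | hLt
  · refine (abs_le_rpow_of_abs_deriv_le hη0.le hη1 hL.le hg hg0 ht.1 hLt fun s hs =>
      hbound s ⟨hs.1, hs.2.trans ht.2⟩).trans ?_
    exact le_mul_of_one_le_left (by positivity) (by linarith)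
  · refine (abs_le_gronwallBound_of_abs_deriv_le hη0.le hη1.le hL.le hg hg0 hbound ht).trans ?_
    have : 1 ≤ (2 * L * t) ^ (1 / (1 - η)) := Real.one_le_rpow (by linarith) hp
    nlinarith
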